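/- For every φ ∈ E of the form φ = −eᵢ − eⱼ with i ≠ j, both i and j even, and for every ψ ∈ Φ such that ψ ∉ E, ψ ≠ φ and ψ − φ ∉ Φ, there exists ω ∈ E such that either (ω + ψ ∈ Φ and ω + ψ ≠ φ and (ω + ψ) − φ ∉ Φ) or (ω = −ψ and ψ ≠ −φ). -/

import Mathlib

/-- The `i`-th standard basis vector of (an ambient copy of) `ℝ^n`. -/
noncomputable def e (i : ℕ) : ℕ → ℝ := Pi.single i 1

/-- The root system of type `Cₙ`: `{eᵢ - eⱼ, eᵢ + eⱼ, -eᵢ - eⱼ : i ≠ j} ∪ {±2eᵢ}`,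
indices between `1` and `n`. -/
def PhiC (n : ℕ) : Set (ℕ → ℝ) :=
  {v | ∃ i j : ℕ, 1 ≤ i ∧ i ≤ n ∧ 1 ≤ j ∧ j ≤ n ∧ i ≠ j ∧
      (v = e i - e j ∨ v = e i + e j ∨ v = -e i - e j)} ∪
  {v | ∃ i : ℕ, 1 ≤ i ∧ i ≤ n ∧ (v = (2 : ℝ) • e i ∨ v = -((2 : ℝ) • e i))}

/-- The distinguished subset `E ⊆ Φ` of type `Cₙ`:
`{eᵢ - eⱼ : i odd, j even} ∪ {eₘ + eₚ : m ≠ p odd} ∪ {-eₖ - eₗ : k ≠ l even}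
∪ {2eₜ : t odd} ∪ {-2eₛ : s even}`, indices between `1` and `n`. -/
def EC (n : ℕ) : Set (ℕ → ℝ) :=
  {v | ∃ i j : ℕ, 1 ≤ i ∧ i ≤ n ∧ 1 ≤ j ∧ j ≤ n ∧ Odd i ∧ Even j ∧ v = e i - e j} ∪
  {v | ∃ m p : ℕ, 1 ≤ m ∧ m ≤ n ∧ 1 ≤ p ∧ p ≤ n ∧ m ≠ p ∧ Odd m ∧ Odd p ∧
      v = e m + e p} ∪
  {v | ∃ k l : ℕ, 1 ≤ k ∧ k ≤ n ∧ 1 ≤ l ∧ l ≤ n ∧ k ≠ l ∧ Even k ∧ Even l ∧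
      v = -e k - e l} ∪
  {v | ∃ t : ℕ, 1 ≤ t ∧ t ≤ n ∧ Odd t ∧ v = (2 : ℝ) • e t} ∪
  {v | ∃ s : ℕ, 1 ≤ s ∧ s ≤ n ∧ Even s ∧ v = -((2 : ℝ) • e s)}

/-- The basis vectors with signs adjusted by parity, so that `EC n` consists of their pairwise
sums. -/
noncomputable def signedE (i : ℕ) : ℕ → ℝ := if Even i then -e i else e i

theorem signedE_of_even {i : ℕ} (h : Even i) : signedE i = -e i := if_pos h

theorem signedE_of_odd {i : ℕ} (h : Odd i) : signedE i = e i :=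
  if_neg (Nat.not_even_iff_odd.2 h)

theorem signedE_self_ne_zero (i : ℕ) : signedE i i ≠ 0 := by
  unfold signedE
  split_ifs <;> simp [e]

theorem signedE_apply_of_ne {i k : ℕ} (h : k ≠ i) : signedE i k = 0 := by
  unfold signedE
  split_ifs <;> simp [e, h]

theorem signedE_add_mem_EC {n a b : ℕ} (ha : 1 ≤ a) (han : a ≤ n) (hb : 1 ≤ b) (hbn : b ≤ n) :
    signedE a + signedE b ∈ EC n := by
  unfold EC
  rcases Nat.even_or_odd a with pa | pa <;> rcases Nat.even_or_odd b with pb | pb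
  · rw [signedE_of_even pa, signedE_of_even pb]
    by_cases h : a = b
    · subst h
      exact Or.inr ⟨a, ha, han, pa, by module⟩
    · exact Or.inl (Or.inl (Or.inr ⟨a, b, ha, han, hb, hbn, h, pa, pb, by module⟩))
  · rw [signedE_of_even pa, signedE_of_odd pb]
    exact Or.inl (Or.inl (Or.inl (Or.inl ⟨b, a, hb, hbn, ha, han, pb, pa, by module⟩)))
  · rw [signedE_of_odd pa, signedE_of_even pb]
    exact Or.inl (Or.inl (Or.inl (Or.inl ⟨a, b, ha, han, hb, hbn, pa, pb, by module⟩)))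
  · rw [signedE_of_odd pa, signedE_of_odd pb]
    by_cases h : a = b
    · subst h
      exact Or.inl (Or.inr ⟨a, ha, han, pa, by module⟩)
    · exact Or.inl (Or.inl (Or.inl (Or.inr ⟨a, b, ha, han, hb, hbn, h, pa, pb, rfl⟩)))

theorem e_eq_signedE_or (i : ℕ) : e i = signedE i ∨ e i = -signedE i := by
  unfold signedE
  split_ifs <;> simp

theorem neg_mem_PhiC {n : ℕ} {v : ℕ → ℝ} (h : v ∈ PhiC n) : -v ∈ PhiC n := by
  rcases h with ⟨i, j, hi, hin, hj, hjn, hij, rfl | rfl | rfl⟩ | ⟨i, hi, hin, rfl | rfl⟩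
  · exact Or.inl ⟨j, i, hj, hjn, hi, hin, hij.symm, Or.inl (by module)⟩
  · exact Or.inl ⟨i, j, hi, hin, hj, hjn, hij, Or.inr (Or.inr (by module))⟩
  · exact Or.inl ⟨i, j, hi, hin, hj, hjn, hij, Or.inr (Or.inl (by module))⟩
  · exact Or.inr ⟨i, hi, hin, Or.inr rfl⟩
  · exact Or.inr ⟨i, hi, hin, Or.inl (by module)⟩

theorem EC_subset_PhiC (n : ℕ) : EC n ⊆ PhiC n := by
  rintro v ((((⟨i, j, hi, hin, hj, hjn, oi, ej, rfl⟩ | ⟨i, j, hi, hin, hj, hjn, hij, -, -, rfl⟩) |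
    ⟨i, j, hi, hin, hj, hjn, hij, -, -, rfl⟩) | ⟨i, hi, hin, -, rfl⟩) | ⟨i, hi, hin, -, rfl⟩)
  · refine Or.inl ⟨i, j, hi, hin, hj, hjn, ?_, Or.inl rfl⟩
    rintro rfl
    exact Nat.not_even_iff_odd.2 oi ej
  · exact Or.inl ⟨i, j, hi, hin, hj, hjn, hij, Or.inr (Or.inl rfl)⟩
  · exact Or.inl ⟨i, j, hi, hin, hj, hjn, hij, Or.inr (Or.inr rfl)⟩
  · exact Or.inr ⟨i, hi, hin, Or.inl rfl⟩
  · exact Or.inr ⟨i, hi, hin, Or.inr rfl⟩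

theorem signedE_sub_mem_PhiC {n a b : ℕ} (ha : 1 ≤ a) (han : a ≤ n) (hb : 1 ≤ b) (hbn : b ≤ n)
    (h : a ≠ b) : signedE a - signedE b ∈ PhiC n := by
  rcases Nat.even_or_odd a with pa | pa <;> rcases Nat.even_or_odd b with pb | pb <;>
    simp only [signedE_of_even, signedE_of_odd, pa, pb]
  · exact Or.inl ⟨b, a, hb, hbn, ha, han, h.symm, Or.inl (by module)⟩
  · exact Or.inl ⟨a, b, ha, han, hb, hbn, h, Or.inr (Or.inr rfl)⟩
  · exact Or.inl ⟨a, b, ha, han, hb, hbn, h, Or.inr (Or.inl (by module))⟩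
  · exact Or.inl ⟨a, b, ha, han, hb, hbn, h, Or.inl rfl⟩

theorem exists_signedE_of_mem_PhiC {n : ℕ} {v : ℕ → ℝ} (h : v ∈ PhiC n) :
    ∃ a b : ℕ, 1 ≤ a ∧ a ≤ n ∧ 1 ≤ b ∧ b ≤ n ∧
      (v = signedE a + signedE b ∨ v = -(signedE a + signedE b) ∨
        (a ≠ b ∧ v = signedE a - signedE b)) := by
  rcases h with ⟨i, j, hi, hin, hj, hjn, hij, hv⟩ | ⟨i, hi, hin, hv⟩
  · have key : v = signedE i + signedE j ∨ v = -(signedE i + signedE j) ∨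
        v = signedE i - signedE j ∨ v = signedE j - signedE i := by
      rcases e_eq_signedE_or i with h₁ | h₁ <;> rcases e_eq_signedE_or j with h₂ | h₂ <;>
        rw [h₁, h₂] at hv <;> rcases hv with rfl | rfl | rfl <;>
        first
        | exact Or.inl (by module)
        | exact Or.inr (Or.inl (by module))
        | exact Or.inr (Or.inr (Or.inl (by module)))
        | exact Or.inr (Or.inr (Or.inr (by module)))
    rcases key with h | h | h | h
    · exact ⟨i, j, hi, hin, hj, hjn, Or.inl h⟩
    · exact ⟨i, j, hi, hin, hj, hjn, Or.inr (Or.inl h)⟩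
    · exact ⟨i, j, hi, hin, hj, hjn, Or.inr (Or.inr ⟨hij, h⟩)⟩
    · exact ⟨j, i, hj, hjn, hi, hin, Or.inr (Or.inr ⟨hij.symm, h⟩)⟩
  · refine ⟨i, i, hi, hin, hi, hin, ?_⟩
    rcases e_eq_signedE_or i with h₁ | h₁ <;> rw [h₁] at hv <;> rcases hv with rfl | rfl <;>
      first
      | exact Or.inl (by module)
      | exact Or.inr (Or.inl (by module))

/-- A root has at most two nonzero coordinates. -/
theorem not_mem_PhiC_of_three_ne_zero {n a b c : ℕ} {v : ℕ → ℝ} (hab : a ≠ b) (hac : a ≠ c)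
    (hbc : b ≠ c) (ha : v a ≠ 0) (hb : v b ≠ 0) (hc : v c ≠ 0) : v ∉ PhiC n := by
  intro h
  obtain ⟨p, q, -, -, -, -, h⟩ := exists_signedE_of_mem_PhiC h
  have key : ∀ k, v k ≠ 0 → k = p ∨ k = q := by
    intro k hk
    by_contra! hpq
    apply hk
    rcases h with rfl | rfl | ⟨-, rfl⟩ <;>
      simp [signedE_apply_of_ne hpq.1, signedE_apply_of_ne hpq.2]
  have := key a ha
  have := key b hb
  have := key c hc
  omega

/-- Case 4 of the proof of Lemma A.2 of the paper: `φ = -eᵢ - eⱼ` with `i ≠ j` both even. -/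
theorem stmt_6 (n : ℕ) (hn : 3 ≤ n) :
    ∀ i j : ℕ, 1 ≤ i → i ≤ n → 1 ≤ j → j ≤ n → i ≠ j → Even i → Even j →
      ∀ ψ ∈ PhiC n, ψ ∉ EC n → ψ ≠ -e i - e j → ψ - (-e i - e j) ∉ PhiC n →
        ∃ ω ∈ EC n,
          (ω + ψ ∈ PhiC n ∧ ω + ψ ≠ -e i - e j ∧ (ω + ψ) - (-e i - e j) ∉ PhiC n) ∨
          (ω = -ψ ∧ ψ ≠ -(-e i - e j)) := by
  intro i j hi hin hj hjn hij pi pj ψ hψ hψE hne hsub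
  have hφ : -e i - e j = signedE i + signedE j := by
    rw [signedE_of_even pi, signedE_of_even pj, sub_eq_add_neg]
  rw [hφ] at hne hsub ⊢
  by_cases hneg : ψ = -(signedE i + signedE j)
  · have hki : (1 : ℕ) ≠ i := by
      rintro rfl
      exact Nat.not_even_one pi
    have hkj : (1 : ℕ) ≠ j := by
      rintro rfl
      exact Nat.not_even_one pj
    have hsum : signedE i + signedE 1 + ψ = signedE 1 - signedE j := by
      rw [hneg]
      module
    refine ⟨signedE i + signedE 1, signedE_add_mem_EC hi hin le_rfl (by omega), Or.inl ?_⟩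
    rw [hsum]
    refine ⟨signedE_sub_mem_PhiC le_rfl (by omega) hj hjn hkj, fun h => ?_,
      not_mem_PhiC_of_three_ne_zero hki hkj hij ?_ ?_ ?_⟩
    · have := congrFun h 1
      simp [signedE_apply_of_ne hki, signedE_apply_of_ne hkj, signedE_self_ne_zero] at this
    · simp [signedE_apply_of_ne hki, signedE_apply_of_ne hkj, signedE_self_ne_zero]
    · simp [signedE_apply_of_ne hki.symm, signedE_apply_of_ne hij, signedE_self_ne_zero]
    · have := signedE_self_ne_zero j
      simp only [Pi.sub_apply, Pi.add_apply, signedE_apply_of_ne hkj.symm,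
        signedE_apply_of_ne hij.symm]
      intro h
      apply this
      linarith
  obtain ⟨a, b, ha, han, hb, hbn, rfl | rfl | ⟨hab, rfl⟩⟩ := exists_signedE_of_mem_PhiC hψ
  · exact absurd (signedE_add_mem_EC ha han hb hbn) hψE
  · exact ⟨_, signedE_add_mem_EC ha han hb hbn, Or.inr ⟨(neg_neg _).symm, hneg⟩⟩
  · have neg_sum_mem : ∀ c, 1 ≤ c → c ≤ n → -(signedE b + signedE c) ∈ PhiC n := fun c hc hcn =>
      neg_mem_PhiC (EC_subset_PhiC n (signedE_add_mem_EC hb hbn hc hcn))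
    have hai : a ≠ i := by
      rintro rfl
      apply hsub
      convert neg_sum_mem j hj hjn using 1
      module
    have haj : a ≠ j := by
      rintro rfl
      apply hsub
      convert neg_sum_mem i hi hin using 1
      module
    have hsum : signedE a + signedE b + (signedE a - signedE b) = signedE a + signedE a := by
      module
    refine ⟨_, signedE_add_mem_EC ha han hb hbn, Or.inl ?_⟩
    rw [hsum]
    refine ⟨EC_subset_PhiC n (signedE_add_mem_EC ha han ha han), fun h => ?_,
      not_mem_PhiC_of_three_ne_zero hai haj hij ?_ ?_ ?_⟩
    · have := congrFun h a
      simp [signedE_apply_of_ne hai, signedE_apply_of_ne haj, signedE_self_ne_zero] at this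
    · simp [signedE_apply_of_ne hai, signedE_apply_of_ne haj, signedE_self_ne_zero]
    · simp [signedE_apply_of_ne hai.symm, signedE_apply_of_ne hij, signedE_self_ne_zero]
    · simp [signedE_apply_of_ne haj.symm, signedE_apply_of_ne hij.symm, signedE_self_ne_zero]
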